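/- arXiv:1708.01327 — 2 statements merged into one kernel-verified Lean document; each statement's English description precedes it below -/
import Mathlib

section
/- Let π : Γ → U(H) be a unitary representation of a countable discrete group Γ. Then π is weak mixing if and only if π has no nonzero finite-dimensional subrepresentation, if and only if π ⊗ conj(π) has no nonzero invariant vector. -/
open scoped InnerProductSpace

/-- A continuous linear map between inner product spaces is Hilbert–Schmidt
if the sums `∑ ‖T v‖²` over finite orthonormal families are uniformly
bounded. -/
def IsHilbertSchmidt {K H : Type} [NormedAddCommGroup K]
    [InnerProductSpace ℂ K] [NormedAddCommGroup H] [InnerProductSpace ℂ H]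
    (T : K →L[ℂ] H) : Prop :=
  ∃ C : ℝ, ∀ s : Finset K, (∀ v ∈ s, ‖v‖ = 1) →
    (∀ v ∈ s, ∀ w ∈ s, v ≠ w → ⟪v, w⟫_ℂ = 0) →
    ∑ v ∈ s, ‖T v‖ ^ 2 ≤ C

/-- A unitary representation `π` of `Γ` on `H` is weak mixing: matrix
coefficients over finite sets of vectors can be made simultaneously small. -/
def IsWeakMixingRep (Γ : Type) [Group Γ] (H : Type) [NormedAddCommGroup H]
    [InnerProductSpace ℂ H] (π : Γ →* (H ≃ₗᵢ[ℂ] H)) : Prop :=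
  ∀ (ε : ℝ), 0 < ε → ∀ s : Finset H,
    ∃ γ : Γ, ∀ ξ ∈ s, ∀ η ∈ s, ‖(⟪ξ, π γ η⟫_ℂ : ℂ)‖ < ε

open Filter Topology
open scoped ENNReal

theorem IsWeakMixingRep.not_exists_finiteDimensional_subrep {Γ H : Type} [Group Γ]
    [NormedAddCommGroup H] [InnerProductSpace ℂ H] {π : Γ →* (H ≃ₗᵢ[ℂ] H)}
    (hπ : IsWeakMixingRep Γ H π) :
    ¬ ∃ V : Submodule ℂ H, V ≠ ⊥ ∧ FiniteDimensional ℂ V ∧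
      ∀ (γ : Γ), ∀ x ∈ V, π γ x ∈ V := by
  classical
  rintro ⟨V, hV, hfin, hinv⟩
  let b := stdOrthonormalBasis ℂ V
  set n := Module.finrank ℂ V
  have : Nontrivial V := Submodule.nontrivial_iff_ne_bot.mpr hV
  have hn : 0 < n := Module.finrank_pos
  have hn' : (1 : ℝ) ≤ n := by exact_mod_cast hn
  obtain ⟨γ, hγ⟩ := hπ (1 / n) (by positivity) (Finset.univ.image fun i => (b i : H))
  have hmem (i : Fin n) : (b i : H) ∈ Finset.univ.image fun i => (b i : H) :=
    Finset.mem_image_of_mem _ (Finset.mem_univ i)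
  let j : Fin n := ⟨0, hn⟩
  let v : V := ⟨π γ (b j), hinv γ _ (b j).2⟩
  have hv : ‖v‖ = 1 := by
    change ‖π γ (b j : H)‖ = 1
    rw [LinearIsometryEquiv.norm_map]
    exact b.orthonormal.1 j
  have hsum := b.sum_sq_norm_inner_right v
  have hlt : ∑ i, ‖⟪b i, v⟫_ℂ‖ ^ 2 < ∑ _i : Fin n, 1 / (n : ℝ) := by
    refine Finset.sum_lt_sum_of_nonempty ⟨j, Finset.mem_univ j⟩ fun i _ => ?_
    have h : ‖⟪b i, v⟫_ℂ‖ < 1 / n := hγ _ (hmem i) _ (hmem j)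
    have : 1 / (n : ℝ) ≤ 1 := by rw [div_le_one (by linarith)]; exact hn'
    nlinarith [norm_nonneg ⟪b i, v⟫_ℂ]
  rw [hsum, hv] at hlt
  simp [hn.ne'] at hlt

theorem IsHilbertSchmidt.isCompactOperator {K H : Type} [NormedAddCommGroup K]
    [InnerProductSpace ℂ K] [NormedAddCommGroup H] [InnerProductSpace ℂ H] [CompleteSpace H]
    {T : K →L[ℂ] H} (hT : IsHilbertSchmidt T) : IsCompactOperator T := by
  classical
  obtain ⟨C, hC⟩ := hT
  let A : Set ℝ := {r | ∃ s : Finset K, (∀ v ∈ s, ‖v‖ = 1) ∧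
    (∀ v ∈ s, ∀ w ∈ s, v ≠ w → ⟪v, w⟫_ℂ = 0) ∧ r = ∑ v ∈ s, ‖T v‖ ^ 2}
  have hA : A.Nonempty := ⟨_, ∅, by simp, by simp, rfl⟩
  have hAC : BddAbove A := ⟨C, by rintro _ ⟨s, h1, h2, rfl⟩; exact hC s h1 h2⟩
  suffices h : T ∈ closure {S : K →L[ℂ] H | IsCompactOperator S} from
    isClosed_setOfPred_isCompactOperator.closure_subset h
  refine Metric.mem_closure_iff.mpr fun ε hε => ?_
  obtain ⟨_, ⟨s, h1, h2, rfl⟩, hs⟩ :=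
    exists_lt_of_lt_csSup hA (sub_lt_self (sSup A) (show 0 < (ε / 2) ^ 2 by positivity))
  let V := Submodule.span ℂ (s : Set K)
  have : FiniteDimensional ℂ V := FiniteDimensional.span_finset ℂ s
  have hunit (v : K) (hv : v ∈ Vᗮ) (hv1 : ‖v‖ = 1) : ‖T v‖ ≤ ε / 2 := by
    have hsv (w : K) (hw : w ∈ s) : ⟪w, v⟫_ℂ = 0 := hv w (Submodule.subset_span hw)
    have hvs : v ∉ s := fun h => by
      have hv0 : v = 0 := inner_self_eq_zero.mp (hsv v h)
      simp [hv0] at hv1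
    have hle : ∑ w ∈ insert v s, ‖T w‖ ^ 2 ≤ sSup A := by
      refine le_csSup hAC ⟨insert v s, ?_, ?_, rfl⟩
      · simpa [hv1] using h1
      · intro w hw x hx hwx
        rcases Finset.mem_insert.mp hw with rfl | hws <;>
          rcases Finset.mem_insert.mp hx with rfl | hxs
        · exact absurd rfl hwx
        · exact inner_eq_zero_symm.mp (hsv x hxs)
        · exact hsv w hws
        · exact h2 w hws x hxs hwx
    rw [Finset.sum_insert hvs] at hle
    exact le_of_sq_le_sq (by linarith) (by positivity)
  have horth (v : K) (hv : v ∈ Vᗮ) : ‖T v‖ ≤ ε / 2 * ‖v‖ := by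
    rcases eq_or_ne v 0 with rfl | hv0
    · simp
    have h := hunit _ (Vᗮ.smul_mem ((‖v‖⁻¹ : ℝ) : ℂ) hv) (by simp [norm_smul, hv0])
    rw [map_smul, norm_smul] at h
    simp only [Complex.ofReal_inv, norm_inv, Complex.norm_real, norm_norm] at h
    rwa [inv_mul_le_iff₀ (norm_pos_iff.mpr hv0), mul_comm] at h
  refine ⟨T ∘L V.starProjection, ?_, ?_⟩
  · exact (isCompactOperator_of_locallyCompactSpace_rng (T ∘L V.subtypeL)).comp_clm
      V.orthogonalProjectionOnto
  · rw [dist_eq_norm]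
    refine (ContinuousLinearMap.opNorm_le_bound _ (by positivity) fun v => ?_).trans_lt
      (half_lt_self hε)
    have hsub : (T - T ∘L V.starProjection) v = T (Vᗮ.starProjection v) := by
      simp [Submodule.starProjection_orthogonal']
    rw [hsub]
    refine (horth _ (Submodule.starProjection_apply_mem _ _)).trans ?_
    gcongr
    exact Vᗮ.norm_starProjection_apply_le v

theorem exists_finiteDimensional_subrep_of_isHilbertSchmidt {Γ H : Type} [Group Γ]
    [NormedAddCommGroup H] [InnerProductSpace ℂ H] [CompleteSpace H] {π : Γ →* (H ≃ₗᵢ[ℂ] H)}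
    {T : H →L[ℂ] H} (hT : IsHilbertSchmidt T) (hT0 : T ≠ 0)
    (hπT : ∀ (γ : Γ) (x : H), π γ (T x) = T (π γ x)) :
    ∃ V : Submodule ℂ H, V ≠ ⊥ ∧ FiniteDimensional ℂ V ∧
      ∀ (γ : Γ), ∀ x ∈ V, π γ x ∈ V := by
  let S : H →L[ℂ] H := T.adjoint ∘L T
  have hinner (γ : Γ) (x y : H) : ⟪π γ x, y⟫_ℂ = ⟪x, π γ⁻¹ y⟫_ℂ := by
    rw [← (π γ).inner_map_map x (π γ⁻¹ y), map_inv, LinearIsometryEquiv.inv_def,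
      LinearIsometryEquiv.apply_symm_apply]
  have hadj (γ : Γ) (x : H) : π γ (T.adjoint x) = T.adjoint (π γ x) := by
    refine ext_inner_right ℂ fun y => ?_
    rw [hinner, T.adjoint_inner_left, T.adjoint_inner_left, hinner, hπT]
  have hScomp : IsCompactOperator S := hT.isCompactOperator.clm_comp T.adjoint
  have hSsymm : S.IsSymmetric := fun x y => by
    simp [S, ContinuousLinearMap.adjoint_inner_left, ContinuousLinearMap.adjoint_inner_right]
  have hS0 : S ≠ 0 := by
    refine fun h => hT0 (ContinuousLinearMap.ext fun x => ?_)
    have := T.apply_norm_sq_eq_inner_adjoint_left x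
    simpa [show T.adjoint ∘L T = 0 from h] using this
  have h := mt (ContinuousLinearMap.eq_zero_of_forall_hasEigenvalue_eq_zero hScomp hSsymm).mp hS0
  push Not at h
  obtain ⟨μ, hμ, hμ0⟩ := h
  refine ⟨Module.End.eigenspace (S : Module.End ℂ H) μ, Module.End.hasEigenvalue_iff.mp hμ,
    ContinuousLinearMap.finite_dimensional_eigenspace hScomp μ hμ0, fun γ x hx => ?_⟩
  rw [Module.End.mem_eigenspace_iff] at hx ⊢
  change T.adjoint (T x) = μ • x at hx
  change T.adjoint (T (π γ x)) = μ • π γ x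
  rw [← hπT, ← hadj, hx, map_smul]

/-- The square of the Hilbert–Schmidt norm of `T`, computed in the Hilbert basis `b`. -/
noncomputable def hilbertSchmidtSq {ι H : Type} [NormedAddCommGroup H] [InnerProductSpace ℂ H]
    (b : HilbertBasis ι ℂ H) (T : H →L[ℂ] H) : ℝ≥0∞ :=
  ∑' i, ENNReal.ofReal (‖T (b i)‖ ^ 2)

theorem HilbertBasis.tsum_ofReal_norm_inner_sq {ι H : Type} [NormedAddCommGroup H]
    [InnerProductSpace ℂ H] (b : HilbertBasis ι ℂ H) (x : H) :
    ∑' i, ENNReal.ofReal (‖⟪b i, x⟫_ℂ‖ ^ 2) = ENNReal.ofReal (‖x‖ ^ 2) := by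
  have h : HasSum (fun i => ‖⟪b i, x⟫_ℂ‖ ^ 2) (‖x‖ ^ 2) := by
    have := lp.hasSum_norm (p := 2) (by norm_num) (b.repr x)
    simpa [b.repr_apply_apply] using this
  rw [← h.tsum_eq, ENNReal.ofReal_tsum_of_nonneg (fun i => by positivity) h.summable]

section HilbertSchmidtSq

variable {ι H : Type} [NormedAddCommGroup H] [InnerProductSpace ℂ H]
  (b : HilbertBasis ι ℂ H)

theorem hilbertSchmidtSq_add_add_hilbertSchmidtSq_sub (S T : H →L[ℂ] H) :
    hilbertSchmidtSq b (S + T) + hilbertSchmidtSq b (S - T) =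
      2 * (hilbertSchmidtSq b S + hilbertSchmidtSq b T) := by
  simp_rw [hilbertSchmidtSq, ← ENNReal.tsum_add, ← ENNReal.tsum_mul_left]
  refine tsum_congr fun i => ?_
  rw [← ENNReal.ofReal_add (by positivity) (by positivity),
    ← ENNReal.ofReal_add (by positivity) (by positivity),
    show (2 : ℝ≥0∞) = ENNReal.ofReal 2 by simp, ← ENNReal.ofReal_mul (by norm_num)]
  congr 1
  have := parallelogram_law_with_norm ℂ (S (b i)) (T (b i))
  simp only [_root_.add_apply, _root_.sub_apply]
  linarith

theorem hilbertSchmidtSq_smul (c : ℂ) (T : H →L[ℂ] H) :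
    hilbertSchmidtSq b (c • T) = ENNReal.ofReal (‖c‖ ^ 2) * hilbertSchmidtSq b T := by
  simp_rw [hilbertSchmidtSq, ← ENNReal.tsum_mul_left]
  refine tsum_congr fun i => ?_
  rw [← ENNReal.ofReal_mul (by positivity), _root_.smul_apply, norm_smul, mul_pow]

theorem hilbertSchmidtSq_add_ne_top {S T : H →L[ℂ] H} (hS : hilbertSchmidtSq b S ≠ ⊤)
    (hT : hilbertSchmidtSq b T ≠ ⊤) : hilbertSchmidtSq b (S + T) ≠ ⊤ := by
  refine ne_top_of_le_ne_top ?_ (le_self_add (b := hilbertSchmidtSq b (S - T)))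
  rw [hilbertSchmidtSq_add_add_hilbertSchmidtSq_sub]
  exact ENNReal.mul_ne_top (by simp) (ENNReal.add_ne_top.mpr ⟨hS, hT⟩)

theorem hilbertSchmidtSq_sum_ne_top {α : Type*} (s : Finset α) (T : α → H →L[ℂ] H)
    (hT : ∀ a ∈ s, hilbertSchmidtSq b (T a) ≠ ⊤) : hilbertSchmidtSq b (∑ a ∈ s, T a) ≠ ⊤ :=
  Finset.sum_induction T (fun S => hilbertSchmidtSq b S ≠ ⊤)
    (fun _ _ => hilbertSchmidtSq_add_ne_top b) (by simp [hilbertSchmidtSq]) hT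

theorem hilbertSchmidtSq_rankOne (x y : H) :
    hilbertSchmidtSq b (InnerProductSpace.rankOne ℂ x y) =
      ENNReal.ofReal (‖x‖ ^ 2) * ENNReal.ofReal (‖y‖ ^ 2) := by
  rw [hilbertSchmidtSq, ← b.tsum_ofReal_norm_inner_sq y, ← ENNReal.tsum_mul_left]
  refine tsum_congr fun i => ?_
  rw [← ENNReal.ofReal_mul (by positivity), InnerProductSpace.rankOne_apply, norm_smul, mul_pow,
    norm_inner_symm, mul_comm]

/-- Conjugation of a bounded operator by a unitary. -/
noncomputable def unitaryConj (U : H ≃ₗᵢ[ℂ] H) (T : H →L[ℂ] H) : H →L[ℂ] H :=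
  (U.toContinuousLinearEquiv : H →L[ℂ] H) ∘L T ∘L (U.symm.toContinuousLinearEquiv : H →L[ℂ] H)

theorem unitaryConj_apply (U : H ≃ₗᵢ[ℂ] H) (T : H →L[ℂ] H) (x : H) :
    unitaryConj U T x = U (T (U.symm x)) := rfl

theorem continuous_unitaryConj (U : H ≃ₗᵢ[ℂ] H) : Continuous (unitaryConj U) := by
  unfold unitaryConj
  fun_prop

variable [CompleteSpace H]

theorem hilbertSchmidtSq_adjoint (T : H →L[ℂ] H) :
    hilbertSchmidtSq b T.adjoint = hilbertSchmidtSq b T := by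
  simp_rw [hilbertSchmidtSq, ← b.tsum_ofReal_norm_inner_sq]
  rw [ENNReal.tsum_comm]
  refine tsum_congr fun i => tsum_congr fun j => ?_
  rw [ContinuousLinearMap.adjoint_inner_right, norm_inner_symm]

theorem sum_ofReal_norm_sq_le_hilbertSchmidtSq (T : H →L[ℂ] H) (s : Finset H)
    (hs : ∀ v ∈ s, ‖v‖ = 1) (hs' : ∀ v ∈ s, ∀ w ∈ s, v ≠ w → ⟪v, w⟫_ℂ = 0) :
    ENNReal.ofReal (∑ v ∈ s, ‖T v‖ ^ 2) ≤ hilbertSchmidtSq b T := by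
  have horth : Orthonormal ℂ (Subtype.val : s → H) :=
    ⟨fun v => hs v v.2, fun v w hvw => hs' v v.2 w w.2 (Subtype.coe_injective.ne hvw)⟩
  rw [ENNReal.ofReal_sum_of_nonneg fun v _ => by positivity, ← hilbertSchmidtSq_adjoint]
  simp_rw [← b.tsum_ofReal_norm_inner_sq]
  rw [← Summable.tsum_finsetSum fun _ _ => ENNReal.summable]
  refine ENNReal.tsum_le_tsum fun i => ?_
  rw [← ENNReal.ofReal_sum_of_nonneg fun v _ => by positivity]
  refine ENNReal.ofReal_le_ofReal ?_
  have h := horth.sum_inner_products_le (s := Finset.univ) (T.adjoint (b i))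
  rw [Finset.sum_coe_sort s fun v => ‖⟪v, T.adjoint (b i)⟫_ℂ‖ ^ 2] at h
  refine le_of_eq_of_le (Finset.sum_congr rfl fun v _ => ?_) h
  rw [ContinuousLinearMap.adjoint_inner_right, norm_inner_symm]

theorem ofReal_norm_sq_le_hilbertSchmidtSq (T : H →L[ℂ] H) :
    ENNReal.ofReal (‖T‖ ^ 2) ≤ hilbertSchmidtSq b T := by
  rcases eq_or_ne (hilbertSchmidtSq b T) ⊤ with h | h
  · simp [h]
  rw [ENNReal.ofReal_le_iff_le_toReal h]
  refine (Real.le_sqrt (norm_nonneg _) ENNReal.toReal_nonneg).mp ?_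
  refine T.opNorm_le_of_unit_norm (Real.sqrt_nonneg _) fun v hv => ?_
  refine Real.le_sqrt_of_sq_le ((ENNReal.ofReal_le_iff_le_toReal h).mp ?_)
  simpa using sum_ofReal_norm_sq_le_hilbertSchmidtSq b T {v} (by simpa) (by simp)

theorem hilbertSchmidtSq_unitaryConj (U : H ≃ₗᵢ[ℂ] H) (T : H →L[ℂ] H) :
    hilbertSchmidtSq b (unitaryConj U T) = hilbertSchmidtSq b T := by
  have hleft (S : H →L[ℂ] H) :
      hilbertSchmidtSq b ((U.toContinuousLinearEquiv : H →L[ℂ] H) ∘L S) =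
        hilbertSchmidtSq b S := by
    simp [hilbertSchmidtSq]
  have hadj : (T ∘L (U.symm.toContinuousLinearEquiv : H →L[ℂ] H)).adjoint =
      (U.toContinuousLinearEquiv : H →L[ℂ] H) ∘L T.adjoint := by
    symm
    rw [ContinuousLinearMap.eq_adjoint_iff]
    intro x y
    rw [← U.symm.inner_map_map]
    simp [ContinuousLinearMap.adjoint_inner_left]
  rw [unitaryConj, hleft, ← hilbertSchmidtSq_adjoint, hadj, hleft, hilbertSchmidtSq_adjoint]

/-- A midpoint-convex set of Hilbert–Schmidt operators which is stable under conjugation by a family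
of unitaries has in its closure a Hilbert–Schmidt operator fixed by these conjugations. -/
theorem exists_mem_closure_isHilbertSchmidt_unitaryConj_eq {Γ : Type*} (π : Γ → (H ≃ₗᵢ[ℂ] H))
    (K : Set (H →L[ℂ] H)) (hne : K.Nonempty) (hfin : ∀ S ∈ K, hilbertSchmidtSq b S ≠ ⊤)
    (hmid : ∀ S ∈ K, ∀ T ∈ K, (1 / 2 : ℂ) • (S + T) ∈ K)
    (hconj : ∀ γ, ∀ S ∈ K, unitaryConj (π γ) S ∈ K) :
    ∃ T ∈ closure K, IsHilbertSchmidt T ∧ ∀ γ, unitaryConj (π γ) T = T := by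
  let N (S : H →L[ℂ] H) : ℝ := (hilbertSchmidtSq b S).toReal
  let d : ℝ := sInf (N '' K)
  have hbdd : BddBelow (N '' K) := ⟨0, by rintro _ ⟨S, -, rfl⟩; exact ENNReal.toReal_nonneg⟩
  have hd (S : H →L[ℂ] H) (hS : S ∈ K) : d ≤ N S := csInf_le hbdd ⟨S, hS, rfl⟩
  have hdiff (S : H →L[ℂ] H) (hS : S ∈ K) (T : H →L[ℂ] H) (hT : T ∈ K) :
      ‖S - T‖ ^ 2 ≤ 2 * (N S - d) + 2 * (N T - d) := by
    have hpar := hilbertSchmidtSq_add_add_hilbertSchmidtSq_sub b S T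
    have htop : 2 * (hilbertSchmidtSq b S + hilbertSchmidtSq b T) ≠ ⊤ :=
      ENNReal.mul_ne_top (by simp) (ENNReal.add_ne_top.mpr ⟨hfin S hS, hfin T hT⟩)
    rw [← hpar, ENNReal.add_ne_top] at htop
    have hreal := congrArg ENNReal.toReal hpar
    rw [ENNReal.toReal_add htop.1 htop.2, ENNReal.toReal_mul,
      ENNReal.toReal_add (hfin S hS) (hfin T hT), ENNReal.toReal_ofNat] at hreal
    have hle := (ENNReal.ofReal_le_iff_le_toReal htop.2).mp
      (ofReal_norm_sq_le_hilbertSchmidtSq b (S - T))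
    have hm := hd _ (hmid S hS T hT)
    simp only [N, hilbertSchmidtSq_smul, ENNReal.toReal_mul] at hm
    rw [ENNReal.toReal_ofReal (by positivity)] at hm
    norm_num at hm
    simp only [N]
    linarith
  obtain ⟨u, -, hu, huK⟩ := exists_seq_tendsto_sInf (hne.image N) hbdd
  choose A hAK hA using huK
  replace hA : Tendsto (fun n => N (A n)) atTop (𝓝 d) := by simpa only [hA] using hu
  have hcauchy : CauchySeq A := by
    refine Metric.cauchySeq_iff.mpr fun ε hε => ?_
    obtain ⟨n₀, hn₀⟩ := eventually_atTop.mp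
      (hA.eventually_lt_const (show d < d + ε ^ 2 / 4 by linarith [pow_pos hε 2]))
    refine ⟨n₀, fun m hm n hn => ?_⟩
    rw [dist_eq_norm]
    refine lt_of_pow_lt_pow_left₀ 2 hε.le ?_
    linarith [hdiff _ (hAK m) _ (hAK n), hn₀ m hm, hn₀ n hn]
  obtain ⟨T, hT⟩ := cauchySeq_tendsto_of_complete hcauchy
  refine ⟨T, mem_closure_of_tendsto hT (Eventually.of_forall hAK), ⟨d, fun s hs hs' => ?_⟩,
    fun γ => ?_⟩
  · have hlim : Tendsto (fun n => ∑ v ∈ s, ‖A n v‖ ^ 2) atTop (𝓝 (∑ v ∈ s, ‖T v‖ ^ 2)) :=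
      tendsto_finsetSum _ fun v _ =>
        (((ContinuousLinearMap.apply ℂ H v).continuous.tendsto T).comp hT).norm.pow 2
    exact le_of_tendsto_of_tendsto' hlim hA fun n =>
      (ENNReal.ofReal_le_iff_le_toReal (hfin _ (hAK n))).mp
        (sum_ofReal_norm_sq_le_hilbertSchmidtSq b (A n) s hs hs')
  · have hlim : Tendsto (fun n => ‖unitaryConj (π γ) (A n) - A n‖ ^ 2) atTop
        (𝓝 (‖unitaryConj (π γ) T - T‖ ^ 2)) :=
      ((((continuous_unitaryConj (π γ)).tendsto T).comp hT).sub hT).norm.pow 2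
    have hzero : Tendsto (fun n => 2 * (N (A n) - d) + 2 * (N (A n) - d)) atTop (𝓝 0) := by
      have := ((hA.sub_const d).const_mul 2).add ((hA.sub_const d).const_mul 2)
      simpa using this
    have hle := le_of_tendsto_of_tendsto' hlim hzero fun n => by
      have := hdiff _ (hconj γ _ (hAK n)) _ (hAK n)
      simpa only [N, hilbertSchmidtSq_unitaryConj] using this
    exact sub_eq_zero.mp (norm_eq_zero.mp (pow_eq_zero_iff two_ne_zero |>.mp
      (le_antisymm hle (by positivity))))

end HilbertSchmidtSq

theorem exists_isHilbertSchmidt_of_not_isWeakMixingRep {Γ H : Type} [Group Γ]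
    [NormedAddCommGroup H] [InnerProductSpace ℂ H] [CompleteSpace H] {π : Γ →* (H ≃ₗᵢ[ℂ] H)}
    (hπ : ¬ IsWeakMixingRep Γ H π) :
    ∃ T : H →L[ℂ] H, IsHilbertSchmidt T ∧ T ≠ 0 ∧
      ∀ (γ : Γ) (x : H), π γ (T x) = T (π γ x) := by
  obtain ⟨w, b, -⟩ := exists_hilbertBasis ℂ H
  simp only [IsWeakMixingRep, not_forall, not_exists, not_lt] at hπ
  obtain ⟨ε, hε, s, hs⟩ := hπ
  let ℓ (S : H →L[ℂ] H) : ℝ := ∑ ξ ∈ s, (⟪ξ, S ξ⟫_ℂ).re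
  have hℓ : Continuous ℓ := by fun_prop
  have hmul (γ δ : Γ) (S : H →L[ℂ] H) :
      unitaryConj (π γ) (unitaryConj (π δ) S) = unitaryConj (π (γ * δ)) S := by
    ext x
    simp [unitaryConj_apply, LinearIsometryEquiv.mul_def]
  let K : Set (H →L[ℂ] H) :=
    {S | hilbertSchmidtSq b S ≠ ⊤ ∧ ∀ γ, ε ^ 2 ≤ ℓ (unitaryConj (π γ) S)}
  have hne : K.Nonempty := by
    refine ⟨∑ η ∈ s, InnerProductSpace.rankOne ℂ η η, hilbertSchmidtSq_sum_ne_top b _ _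
      fun η _ => ?_, fun γ => ?_⟩
    · rw [hilbertSchmidtSq_rankOne]
      exact ENNReal.mul_ne_top ENNReal.ofReal_ne_top ENNReal.ofReal_ne_top
    · obtain ⟨ξ, hξ, η, hη, h⟩ := hs γ
      have hterm (ξ : H) :
          (⟪ξ, unitaryConj (π γ) (∑ η ∈ s, InnerProductSpace.rankOne ℂ η η) ξ⟫_ℂ).re =
            ∑ η ∈ s, ‖⟪ξ, π γ η⟫_ℂ‖ ^ 2 := by
        simp only [unitaryConj_apply, _root_.sum_apply,
          InnerProductSpace.rankOne_apply, map_sum, map_smul, inner_sum, inner_smul_right,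
          Complex.re_sum]
        refine Finset.sum_congr rfl fun η _ => ?_
        rw [← (π γ).inner_map_map η, LinearIsometryEquiv.apply_symm_apply,
          ← inner_conj_symm (π γ η) ξ, Complex.conj_mul']
        norm_cast
      calc ε ^ 2 ≤ ‖⟪ξ, π γ η⟫_ℂ‖ ^ 2 := by gcongr
        _ ≤ ∑ η ∈ s, ‖⟪ξ, π γ η⟫_ℂ‖ ^ 2 :=
          Finset.single_le_sum (f := fun η => ‖⟪ξ, π γ η⟫_ℂ‖ ^ 2) (fun _ _ => by positivity) hη
        _ ≤ ∑ ξ ∈ s, ∑ η ∈ s, ‖⟪ξ, π γ η⟫_ℂ‖ ^ 2 :=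
          Finset.single_le_sum (f := fun ξ => ∑ η ∈ s, ‖⟪ξ, π γ η⟫_ℂ‖ ^ 2)
            (fun _ _ => by positivity) hξ
        _ = _ := Finset.sum_congr rfl fun ξ _ => (hterm ξ).symm
  have hmid (S : H →L[ℂ] H) (hS : S ∈ K) (T : H →L[ℂ] H) (hT : T ∈ K) :
      (1 / 2 : ℂ) • (S + T) ∈ K := by
    refine ⟨?_, fun γ => ?_⟩
    · rw [hilbertSchmidtSq_smul]
      exact ENNReal.mul_ne_top ENNReal.ofReal_ne_top (hilbertSchmidtSq_add_ne_top b hS.1 hT.1)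
    · have h : ℓ (unitaryConj (π γ) ((1 / 2 : ℂ) • (S + T))) =
          1 / 2 * (ℓ (unitaryConj (π γ) S) + ℓ (unitaryConj (π γ) T)) := by
        simp only [ℓ, ← Finset.sum_add_distrib, Finset.mul_sum]
        refine Finset.sum_congr rfl fun ξ _ => ?_
        simp [unitaryConj_apply, mul_add]
      linarith [hS.2 γ, hT.2 γ]
  obtain ⟨T, hTK, hT, hinv⟩ := exists_mem_closure_isHilbertSchmidt_unitaryConj_eq b π K hne
    (fun S hS => hS.1) hmid fun γ S hS =>
      ⟨by rw [hilbertSchmidtSq_unitaryConj]; exact hS.1, fun δ => by rw [hmul]; exact hS.2 _⟩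
  refine ⟨T, hT, ?_, fun γ x => ?_⟩
  · rintro rfl
    have hclosed : IsClosed {S : H →L[ℂ] H | ε ^ 2 ≤ ℓ S} := isClosed_le continuous_const hℓ
    have hsub : K ⊆ {S | ε ^ 2 ≤ ℓ S} := fun S hS => by
      have := hS.2 1
      rwa [show unitaryConj (π 1) S = S by rw [map_one]; rfl] at this
    have h : ε ^ 2 ≤ ℓ 0 := closure_minimal hsub hclosed hTK
    have : ℓ 0 = 0 := by simp [ℓ]
    linarith [pow_pos hε 2]
  · conv_rhs => rw [← hinv γ]
    simp [unitaryConj_apply]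

/-- A unitary representation `π` of a countable discrete group is weak mixing
iff it has no nonzero finite-dimensional invariant subspace, iff `π ⊗ conj π`
has no nonzero invariant vector (i.e. there is no nonzero `π`-equivariant
Hilbert–Schmidt operator on `H`). -/
theorem weakMixing_iff_no_finiteDimensional_subrep
    (Γ : Type) [Group Γ] [Countable Γ]
    (H : Type) [NormedAddCommGroup H] [InnerProductSpace ℂ H] [CompleteSpace H]
    (π : Γ →* (H ≃ₗᵢ[ℂ] H)) :
    (IsWeakMixingRep Γ H π ↔
      ¬ ∃ V : Submodule ℂ H, V ≠ ⊥ ∧ FiniteDimensional ℂ V ∧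
          ∀ (γ : Γ), ∀ x ∈ V, π γ x ∈ V) ∧
    (IsWeakMixingRep Γ H π ↔
      ¬ ∃ T : H →L[ℂ] H, IsHilbertSchmidt T ∧ T ≠ 0 ∧
          ∀ (γ : Γ) (x : H), π γ (T x) = T (π γ x)) := by
  have hwm : IsWeakMixingRep Γ H π → ¬ ∃ V : Submodule ℂ H, V ≠ ⊥ ∧ FiniteDimensional ℂ V ∧
      ∀ (γ : Γ), ∀ x ∈ V, π γ x ∈ V :=
    IsWeakMixingRep.not_exists_finiteDimensional_subrep
  refine ⟨⟨hwm, fun hV => ?_⟩, ⟨fun h => ?_, not_imp_comm.mp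
    exists_isHilbertSchmidt_of_not_isWeakMixingRep⟩⟩
  · by_contra h
    obtain ⟨T, hT, hT0, hπT⟩ := exists_isHilbertSchmidt_of_not_isWeakMixingRep h
    exact hV (exists_finiteDimensional_subrep_of_isHilbertSchmidt hT hT0 hπT)
  · rintro ⟨T, hT, hT0, hπT⟩
    exact hwm h (exists_finiteDimensional_subrep_of_isHilbertSchmidt hT hT0 hπT)
end

section
/- Let R be an ergodic countable probability-measure-preserving equivalence relation on a standard probability space (X, μ) such that almost every R-class is infinite, and let F : X → {finite subsets of X} be a Borel assignment with F_x ⊆ [x]_R for almost every x. Then for every ε > 0 there exists an element T of the full group [R] such that μ({x ∈ X : T(x) ∈ F_x}) < ε. -/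
open MeasureTheory

/-- The box `∏ i, [0, k i]` of the Baire space is compact. -/
theorem isCompact_setOf_forall_le (k : ℕ → ℕ) : IsCompact {z : ℕ → ℕ | ∀ i, z i ≤ k i} := by
  have : {z : ℕ → ℕ | ∀ i, z i ≤ k i} = Set.pi Set.univ fun i => Set.Iic (k i) := by
    ext; simp [Pi.le_def]
  rw [this]
  exact isCompact_univ_pi fun i => (Set.finite_Iic (k i)).isCompact

open Set Filter Topology in
/-- If an open set contains the compact box `∏ i, [0, k i]` of the Baire space, then it contains a
cylinder obtained by bounding only finitely many coordinates. -/
theorem exists_cylinder_subset_of_box_subset {k : ℕ → ℕ} {U : Set (ℕ → ℕ)} (hU : IsOpen U)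
    (h : {z : ℕ → ℕ | ∀ i, z i ≤ k i} ⊆ U) :
    ∃ n, {z : ℕ → ℕ | ∀ i < n, z i ≤ k i} ⊆ U := by
  by_contra! hcon
  choose z hz hzU using fun n => Set.not_subset.1 (hcon n)
  obtain ⟨w, hw, φ, hφ, hlim⟩ := (isCompact_setOf_forall_le k).tendsto_subseq (x := fun n i => min (z n i) (k i))
    fun n i => min_le_right _ _
  have hlim' : Tendsto (z ∘ φ) atTop (𝓝 w) := by
    rw [tendsto_pi_nhds] at hlim ⊢
    intro i
    refine (hlim i).congr' ?_
    filter_upwards [eventually_gt_atTop i] with n hn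
    exact min_eq_left (hz _ i (hn.trans_le (hφ.id_le n)))
  obtain ⟨n, hn⟩ := (hlim'.eventually (hU.mem_nhds (h hw))).exists
  exact hzU _ hn

open Set Filter Topology in
/-- Inner approximation of the measure of a continuous image of the Baire space by compact sets. -/
theorem exists_isCompact_subset_range_of_lt_measure {α : Type*} [TopologicalSpace α]
    [MeasurableSpace α] (μ : Measure α) [μ.OuterRegular] {f : (ℕ → ℕ) → α} (hf : Continuous f)
    {r : ENNReal} (hr : r < μ (range f)) : ∃ K ⊆ range f, IsCompact K ∧ r ≤ μ K := by
  have step (s : Set (ℕ → ℕ)) (n : ℕ) (hs : r < μ (f '' s)) :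
      ∃ k, r < μ (f '' (s ∩ {z | z n ≤ k})) := by
    have hmono : Monotone fun k => f '' (s ∩ {z | z n ≤ k}) := fun a b hab =>
      image_mono fun z hz => ⟨hz.1, le_trans hz.2 hab⟩
    have hU : ⋃ k, f '' (s ∩ {z | z n ≤ k}) = f '' s := by
      rw [← image_iUnion, ← inter_iUnion]
      congr 1
      exact inter_eq_left.2 fun z _ => mem_iUnion.2 ⟨z n, le_refl (z n)⟩
    rw [← hU, hmono.measure_iUnion] at hs
    exact lt_iSup_iff.1 hs
  choose! c hc using step
  let C : ℕ → Set (ℕ → ℕ) := fun n => Nat.rec univ (fun n s => s ∩ {z | z n ≤ c s n}) n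
  let k : ℕ → ℕ := fun n => c (C n) n
  have hC (n : ℕ) : r < μ (f '' C n) := by
    induction n with
    | zero => simpa [C] using hr
    | succ n ih => exact hc _ n ih
  have hCk (n : ℕ) : C n = {z | ∀ i < n, z i ≤ k i} := by
    induction n with
    | zero => simp [C]
    | succ n ih =>
      have : C (n + 1) = C n ∩ {z | z n ≤ k n} := rfl
      rw [this, ih]
      ext z
      simp only [mem_inter_iff, mem_ofPred_eq, Nat.lt_succ_iff_lt_or_eq, or_imp, forall_and,
        forall_eq]
  refine ⟨f '' {z | ∀ i, z i ≤ k i}, image_subset_range _ _, (isCompact_setOf_forall_le k).image hf, ?_⟩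
  rw [Set.measure_eq_iInf_isOpen]
  refine le_iInf₂ fun U hU => le_iInf fun hUo => ?_
  obtain ⟨n, hn⟩ := exists_cylinder_subset_of_box_subset (hUo.preimage hf) (image_subset_iff.1 hU)
  rw [← hCk] at hn
  exact (hC n).le.trans (measure_mono (image_subset_iff.2 hn))

open Set Filter Topology in
/-- Analytic sets are measurable with respect to the completion of every finite Borel measure. -/
theorem MeasureTheory.AnalyticSet.nullMeasurableSet {α : Type*} [TopologicalSpace α] [T2Space α]
    [MeasurableSpace α] [OpensMeasurableSpace α] {μ : Measure α} [IsFiniteMeasure μ]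
    [μ.OuterRegular] {s : Set α} (hs : AnalyticSet s) : NullMeasurableSet s μ := by
  rw [AnalyticSet] at hs
  obtain rfl | ⟨f, hf, rfl⟩ := hs
  · exact .empty
  by_cases h0 : μ (range f) = 0
  · exact .of_null h0
  obtain ⟨u, -, hu, hlim⟩ := exists_seq_strictMono_tendsto' (pos_iff_ne_zero.2 h0)
  choose K hKf hK hKu using fun n => exists_isCompact_subset_range_of_lt_measure μ hf (hu n).2
  have hm : MeasurableSet (⋃ n, K n) := .iUnion fun n => (hK n).measurableSet
  have hsub : ⋃ n, K n ⊆ range f := iUnion_subset hKf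
  have hle : μ (range f) ≤ μ (⋃ n, K n) :=
    le_of_tendsto' hlim fun n => (hKu n).trans (measure_mono (subset_iUnion K n))
  exact hm.nullMeasurableSet.congr
    (ae_eq_of_subset_of_measure_ge hsub hle hm.nullMeasurableSet (measure_ne_top _ _))

/-- A nonempty family of measurable sets closed under countable unions has a largest element modulo
null sets. -/
theorem exists_largest_mod_null {X : Type*} [MeasurableSpace X] (μ : Measure X) [IsFiniteMeasure μ]
    {p : Set X → Prop} (h0 : p ∅) (hU : ∀ s : ℕ → Set X, (∀ n, p (s n)) → p (⋃ n, s n))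
    (hm : ∀ s, p s → MeasurableSet s) : ∃ s, p s ∧ ∀ t, p t → μ (t \ s) = 0 := by
  obtain ⟨u, -, hu, hup⟩ := exists_seq_tendsto_sSup (S := μ '' {s | p s}) ⟨_, ∅, h0, rfl⟩
    (OrderTop.bddAbove _)
  choose s hs hsu using hup
  refine ⟨⋃ n, s n, hU s hs, fun t ht => ?_⟩
  have hpu : p (t ∪ ⋃ n, s n) := by
    have := hU (fun n => if n = 0 then t else ⋃ n, s n) fun n => by
      split_ifs
      exacts [ht, hU s hs]
    convert this using 1
    ext x
    simp only [Set.mem_union, Set.mem_iUnion]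
    constructor
    · rintro (hx | hx)
      exacts [⟨0, by simpa using hx⟩, ⟨1, by simpa using hx⟩]
    · rintro ⟨n, hn⟩
      split_ifs at hn
      exacts [.inl hn, .inr (by simpa using hn)]
  have hle : μ (t ∪ ⋃ n, s n) ≤ μ (⋃ n, s n) := by
    refine (le_sSup (Set.mem_image_of_mem μ hpu)).trans (le_of_tendsto' hu fun n => ?_)
    rw [← hsu]
    exact measure_mono (Set.subset_iUnion s n)
  rw [← Set.union_sdiff_right, measure_sdiff Set.subset_union_right (hm _ (hU s hs)).nullMeasurableSet
    (measure_ne_top _ _)]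
  exact tsub_eq_zero_of_le hle

/-- A nonempty perfect subset of a Polish space is uncountable. -/
theorem Perfect.not_countable {Z : Type*} [TopologicalSpace Z] [PolishSpace Z] {C : Set Z}
    (hC : Perfect C) (hne : C.Nonempty) : ¬ C.Countable := by
  intro hcount
  let := TopologicalSpace.upgradeIsCompletelyMetrizable Z
  obtain ⟨f, hf, -, hinj⟩ := hC.exists_nat_bool_injection hne
  have hlt : Cardinal.aleph0 < Cardinal.mk (ℕ → Bool) := by
    simpa using Cardinal.cantor Cardinal.aleph0
  have h : Countable (ℕ → Bool) := Set.countable_univ_iff.1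
    ((Set.mapsTo_univ_iff.2 fun x => hf ⟨x, rfl⟩).countable_of_injOn hinj.injOn hcount)
  exact (Cardinal.mk_le_aleph0_iff.2 h).not_gt hlt

open Set in
/-- **Lusin–Novikov** modulo null sets: a continuous map with countable fibres is injective on each
of countably many Borel sets which cover all fibres outside a null set. -/
theorem exists_countable_injOn_cover_of_continuous {Z X : Type*} [TopologicalSpace Z] [PolishSpace Z]
    [MeasurableSpace Z] [BorelSpace Z] [TopologicalSpace X] [PolishSpace X] [MeasurableSpace X]
    [BorelSpace X] (μ : Measure X) [IsFiniteMeasure μ] {f : Z → X} (hf : Continuous f)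
    (hcount : ∀ x, (f ⁻¹' {x}).Countable) :
    ∃ 𝒮 : Set (Set Z), 𝒮.Countable ∧ (∀ s ∈ 𝒮, MeasurableSet s ∧ InjOn f s) ∧
      μ (f '' (⋃₀ 𝒮)ᶜ) = 0 := by
  let Small : Set Z → Prop := fun W => ∃ 𝒮 : Set (Set Z), 𝒮.Countable ∧
    (∀ s ∈ 𝒮, MeasurableSet s ∧ InjOn f s) ∧ W ⊆ ⋃₀ 𝒮
  have small_sUnion {𝒲 : Set (Set Z)} (h𝒲 : 𝒲.Countable) (hW : ∀ W ∈ 𝒲, Small W) :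
      Small (⋃₀ 𝒲) := by
    choose! 𝒮 h1 h2 h3 using hW
    refine ⟨⋃ W ∈ 𝒲, 𝒮 W, h𝒲.biUnion h1, fun s hs => ?_, sUnion_subset fun W hW => (h3 W hW).trans
      (sUnion_mono (subset_biUnion_of_mem hW))⟩
    obtain ⟨W, hW, hs⟩ := mem_iUnion₂.1 hs
    exact h2 W hW s hs
  have small_mono {W W' : Set Z} (h : W ⊆ W') (hW : Small W') : Small W := by
    obtain ⟨𝒮, h1, h2, h3⟩ := hW
    exact ⟨𝒮, h1, h2, h.trans h3⟩
  let b := TopologicalSpace.countableBasis Z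
  have hb : TopologicalSpace.IsTopologicalBasis b := TopologicalSpace.isBasis_countableBasis Z
  have : Countable b := (TopologicalSpace.countable_countableBasis Z).to_subtype
  have largest (U : b) := exists_largest_mod_null μ
    (p := fun B => MeasurableSet B ∧ Small (U.1 ∩ f ⁻¹' B))
    ⟨.empty, ∅, countable_empty, by simp, by simp⟩
    (fun s hs => ⟨.iUnion fun n => (hs n).1, by
      rw [preimage_iUnion, inter_iUnion]
      rw [← sUnion_range]
      exact small_sUnion (countable_range _) (forall_mem_range.2 fun n => (hs n).2)⟩)
    fun s hs => hs.1
  choose B hB hBmax using largest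
  let W : Set Z := ⋃ U : b, U.1 ∩ f ⁻¹' B U
  have hW : Small W := by
    dsimp only [W]
    rw [← sUnion_range]
    exact small_sUnion (countable_range _) (forall_mem_range.2 fun U => (hB U).2)
  have hUm (U : b) : MeasurableSet U.1 := (hb.isOpen U.2).measurableSet
  have hWm : MeasurableSet W := .iUnion fun U => (hUm U).inter (hf.measurable (hB U).1)
  let Q : b → Set (Z × Z) := fun U =>
    {q | q.1 ∈ U.1 \ W ∧ q.2 ∈ U.1 \ W ∧ f q.1 = f q.2 ∧ q.1 ≠ q.2}
  let E : b → Set X := fun U => (fun q : Z × Z => f q.1) '' Q U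
  have hQ (U : b) : MeasurableSet (Q U) :=
    (measurable_fst ((hUm U).diff hWm)).inter <| (measurable_snd ((hUm U).diff hWm)).inter <|
      (measurableSet_eq_fun (hf.measurable.comp measurable_fst)
        (hf.measurable.comp measurable_snd)).inter
        (measurableSet_eq_fun measurable_fst measurable_snd).compl
  have hE (U : b) : NullMeasurableSet (E U) μ :=
    ((hQ U).analyticSet_image (hf.measurable.comp measurable_fst)).nullMeasurableSet
  have key (U : b) : ∀ᵐ x ∂μ, x ∈ B U ∨ x ∈ E U := by
    have h1 : ∀ᵐ x ∂μ, x ∉ (toMeasurable μ (E U))ᶜ \ B U := by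
      refine measure_eq_zero_iff_ae_notMem.1 (hBmax U _ ⟨(measurableSet_toMeasurable _ _).compl, ?_⟩)
      have hpiece : Small ((U.1 ∩ f ⁻¹' (toMeasurable μ (E U))ᶜ) \ W) := by
        refine ⟨{_}, countable_singleton _, ?_, (sUnion_singleton _).ge⟩
        rintro s rfl
        refine ⟨((hUm U).inter (hf.measurable (measurableSet_toMeasurable _ _).compl)).diff hWm,
          fun z hz w hw hzw => ?_⟩
        by_contra hne
        exact hz.1.2 (subset_toMeasurable μ _
          ⟨(z, w), ⟨⟨hz.1.1, hz.2⟩, ⟨hw.1.1, hw.2⟩, hzw, hne⟩, rfl⟩)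
      refine small_mono (W' := ⋃₀ {(U.1 ∩ f ⁻¹' (toMeasurable μ (E U))ᶜ) \ W, W}) ?_
        (small_sUnion (by simp) (by simpa using ⟨hpiece, hW⟩))
      rw [sUnion_pair, sdiff_union_self]
      exact subset_union_left
    filter_upwards [h1, (hE U).toMeasurable_ae_eq.mem_iff] with x hx hx'
    by_contra! hcon
    exact hx ⟨fun h => hcon.2 (hx'.1 h), hcon.1⟩
  obtain ⟨𝒮, h𝒮, h𝒮', hsub⟩ := hW
  refine ⟨𝒮, h𝒮, h𝒮', ?_⟩
  refine measure_mono_null (image_mono (compl_subset_compl.2 hsub)) ?_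
  rw [measure_eq_zero_iff_ae_notMem]
  filter_upwards [ae_all_iff.2 key] with x hx hxW
  have hclosed : f ⁻¹' {x} \ W = f ⁻¹' {x} \ ⋃ U : {U : b // x ∈ B U}, U.1.1 := by
    ext z
    simp only [W, mem_sdiff, mem_preimage, mem_singleton_iff, mem_iUnion, mem_inter_iff,
      Subtype.exists, exists_prop, and_congr_right_iff]
    rintro rfl
    exact not_congr (exists_congr fun a => exists_congr fun h => and_comm)
  refine Perfect.not_countable (C := f ⁻¹' {x} \ W) ⟨?_, ?_⟩ ?_ ((hcount x).mono sdiff_subset)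
  · rw [hclosed]
    exact (isClosed_singleton.preimage hf).sdiff (isOpen_iUnion fun U => hb.isOpen U.1.2)
  · intro z hz
    rw [accPt_iff_nhds]
    intro V hV
    obtain ⟨U, hU, hzU, hUV⟩ := hb.mem_nhds_iff.1 hV
    rcases hx ⟨U, hU⟩ with hxB | ⟨q, ⟨h1, h2, h3, h4⟩, hq⟩
    · refine absurd (mem_iUnion.2 ⟨⟨U, hU⟩, hzU, ?_⟩ : z ∈ W) hz.2
      rwa [mem_preimage, show f z = x from hz.1]
    · by_cases hqz : q.1 = z
      · exact ⟨q.2, ⟨hUV h2.1, h3.symm.trans hq, h2.2⟩, fun h => h4 (hqz.trans h.symm)⟩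
      · exact ⟨q.1, ⟨hUV h1.1, hq, h1.2⟩, hqz⟩
  · obtain ⟨z, hz, rfl⟩ := hxW
    exact ⟨z, rfl, hz⟩

open Set in
/-- **Lusin–Novikov** modulo null sets, for a measurable map with countable fibres on a measurable
subset of a standard Borel space. -/
theorem exists_countable_injOn_cover {Z X : Type*} [MeasurableSpace Z] [StandardBorelSpace Z]
    [MeasurableSpace X] [StandardBorelSpace X] (μ : Measure X) [IsFiniteMeasure μ] {f : Z → X}
    (hf : Measurable f) {Q : Set Z} (hQ : MeasurableSet Q)
    (hcount : ∀ x, (Q ∩ f ⁻¹' {x}).Countable) :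
    ∃ 𝒮 : Set (Set Z), 𝒮.Countable ∧ (∀ s ∈ 𝒮, MeasurableSet s ∧ s ⊆ Q ∧ InjOn f s) ∧
      μ (f '' (Q \ ⋃₀ 𝒮)) = 0 := by
  have := hQ.standardBorel
  let := upgradeStandardBorel X
  obtain ⟨t, htb, htp⟩ := StandardBorelSpace.polish (α := Q)
  obtain ⟨t', ht', hft', htp'⟩ := (hf.comp (measurable_subtype_coe (p := (· ∈ Q)))).exists_continuous
  have : @BorelSpace Q t' _ :=
    ⟨htb.measurable_eq.trans (@borel_eq_borel_of_le _ t' t htp' htp ht').symm⟩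
  let := t'
  obtain ⟨𝒮, h1, h2, h3⟩ := exists_countable_injOn_cover_of_continuous μ hft' fun x => by
    refine MapsTo.countable_of_injOn (f := Subtype.val) (fun z hz => ?_)
      Subtype.val_injective.injOn (hcount x)
    exact ⟨z.2, hz⟩
  refine ⟨(Subtype.val '' ·) '' 𝒮, h1.image _, ?_, ?_⟩
  · rintro _ ⟨s, hs, rfl⟩
    refine ⟨hQ.subtype_image (h2 s hs).1, Subtype.coe_image_subset _ _, ?_⟩
    rintro _ ⟨z, hz, rfl⟩ _ ⟨w, hw, rfl⟩ h
    exact congrArg _ ((h2 s hs).2 hz hw h)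
  · refine measure_mono_null ?_ h3
    rintro _ ⟨z, ⟨hz, hz'⟩, rfl⟩
    refine ⟨⟨z, hz⟩, fun ⟨s, hs, hzs⟩ => hz' ⟨_, ⟨s, hs, rfl⟩, ⟨_, hzs, rfl⟩⟩, rfl⟩

open Set in
/-- A Borel relation with countable sections is, outside a null set of first coordinates, covered by
countably many graphs of Borel partial injections. -/
theorem exists_countable_partialInjection_cover {X : Type*} [MeasurableSpace X]
    [StandardBorelSpace X] (μ : Measure X) [IsFiniteMeasure μ] {Q : Set (X × X)}
    (hQ : MeasurableSet Q) (hfst : ∀ x, {y | (x, y) ∈ Q}.Countable)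
    (hsnd : ∀ y, {x | (x, y) ∈ Q}.Countable) :
    ∃ 𝒦 : Set (Set (X × X)), 𝒦.Countable ∧
      (∀ K ∈ 𝒦, MeasurableSet K ∧ K ⊆ Q ∧ InjOn Prod.fst K ∧ InjOn Prod.snd K) ∧
      ∀ᵐ x ∂μ, ∀ y, (x, y) ∈ Q → (x, y) ∈ ⋃₀ 𝒦 := by
  obtain ⟨𝒮, h𝒮, hS, hnull⟩ := exists_countable_injOn_cover μ measurable_fst hQ fun x => by
    refine MapsTo.countable_of_injOn (f := Prod.snd) (t := {y | (x, y) ∈ Q}) ?_ ?_ (hfst x)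
    · rintro ⟨_, y⟩ ⟨h, rfl⟩
      exact h
    · rintro ⟨_, y⟩ ⟨h, rfl⟩ ⟨_, y'⟩ ⟨h', h''⟩ hyy
      exact Prod.ext h''.symm hyy
  have piece (S : Set (X × X)) (hS𝒮 : S ∈ 𝒮) : ∃ 𝒯 : Set (Set (X × X)), 𝒯.Countable ∧
      (∀ T ∈ 𝒯, MeasurableSet T ∧ T ⊆ S ∧ InjOn Prod.snd T) ∧
      μ (Prod.fst '' (S \ ⋃₀ 𝒯)) = 0 := by
    obtain ⟨hSm, hSQ, hSinj⟩ := hS S hS𝒮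
    have := hSm.standardBorel
    have hg : MeasurableEmbedding fun z : S => z.1.1 :=
      (measurable_fst.comp measurable_subtype_coe).measurableEmbedding
        fun z w h => Subtype.ext (hSinj z.2 w.2 h)
    let M : Measure S := μ.comap fun z => z.1.1
    have hMs (s : Set S) : M s = μ ((fun z : S => z.1.1) '' s) := hg.comap_apply μ s
    have : IsFiniteMeasure M := ⟨by
      rw [hMs]
      exact measure_lt_top _ _⟩
    have hsm : Measurable fun z : S => z.1.2 := measurable_snd.comp measurable_subtype_coe
    obtain ⟨𝒯, h𝒯, hT, hTnull⟩ := exists_countable_injOn_cover (M.map fun z => z.1.2) measurable_snd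
      hSm fun y => by
        refine MapsTo.countable_of_injOn (f := Prod.fst) (t := {x | (x, y) ∈ Q}) ?_ ?_ (hsnd y)
        · rintro ⟨x, _⟩ ⟨h, rfl⟩
          exact hSQ h
        · rintro ⟨x, _⟩ ⟨h, rfl⟩ ⟨x', _⟩ ⟨h', h''⟩ hxx
          exact Prod.ext hxx h''.symm
    refine ⟨𝒯, h𝒯, hT, ?_⟩
    have h0 := le_antisymm ((Measure.le_map_apply hsm.aemeasurable _).trans hTnull.le) zero_le
    rw [hMs] at h0
    refine measure_mono_null ?_ h0
    rintro _ ⟨z, hz, rfl⟩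
    exact ⟨⟨z, hz.1⟩, ⟨z, hz, rfl⟩, rfl⟩
  choose! 𝒯 h𝒯 hT hTnull using piece
  refine ⟨⋃ S ∈ 𝒮, 𝒯 S, h𝒮.biUnion h𝒯, fun K hK => ?_, ?_⟩
  · obtain ⟨S, hS', hK⟩ := mem_iUnion₂.1 hK
    obtain ⟨h1, h2, h3⟩ := hT S hS' K hK
    exact ⟨h1, h2.trans (hS S hS').2.1, (hS S hS').2.2.mono h2, h3⟩
  · have h1 : ∀ᵐ x ∂μ, ∀ S ∈ 𝒮, x ∉ Prod.fst '' (S \ ⋃₀ 𝒯 S) :=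
      (ae_ball_iff h𝒮).2 fun S hS' => measure_eq_zero_iff_ae_notMem.1 (hTnull S hS')
    filter_upwards [h1, measure_eq_zero_iff_ae_notMem.1 hnull] with x hx hx' y hxy
    by_contra hcon
    refine hx' ⟨(x, y), ⟨hxy, ?_⟩, rfl⟩
    rintro ⟨S, hS', hxS⟩
    refine hx S hS' ⟨(x, y), ⟨hxS, ?_⟩, rfl⟩
    rintro ⟨T, hT', hxT⟩
    exact hcon ⟨T, mem_biUnion hS' hT', hxT⟩

open Set in
/-- A symmetric Borel graph of a partial function extends, by the identity, to a Borel involution. -/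
theorem exists_measurable_involution {X : Type*} [MeasurableSpace X] [StandardBorelSpace X]
    {L : Set (X × X)} (hL : MeasurableSet L) (hinj : InjOn Prod.fst L)
    (hsymm : ∀ x y, (x, y) ∈ L → (y, x) ∈ L) :
    ∃ T : X ≃ X, Measurable T ∧ T.symm = T ∧ (∀ x, T x = x ∨ (x, T x) ∈ L) ∧
      ∀ x y, (x, y) ∈ L → T x = y := by
  classical
  let T : X → X := fun x => if h : ∃ y, (x, y) ∈ L then h.choose else x
  have hT {x y : X} (h : (x, y) ∈ L) : T x = y := by
    have hex : ∃ y, (x, y) ∈ L := ⟨y, h⟩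
    have : T x = hex.choose := dif_pos hex
    rw [this]
    exact congrArg Prod.snd (hinj hex.choose_spec h rfl)
  have hT' {x : X} (h : ¬ ∃ y, (x, y) ∈ L) : T x = x := dif_neg h
  have hinv : Function.Involutive T := fun x => by
    by_cases h : ∃ y, (x, y) ∈ L
    · obtain ⟨y, hy⟩ := h
      rw [hT hy, hT (hsymm _ _ hy)]
    · rw [hT' h, hT' h]
  refine ⟨hinv.toPerm, fun s hs => ?_, rfl, fun x => ?_, fun x y h => hT h⟩
  · have : hinv.toPerm ⁻¹' s =
        Prod.fst '' (L ∩ Prod.snd ⁻¹' s) ∪ (s \ Prod.fst '' L) := by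
      ext x
      simp only [mem_preimage, Function.Involutive.coe_toPerm]
      by_cases h : ∃ y, (x, y) ∈ L
      · obtain ⟨y, hy⟩ := h
        rw [hT hy]
        constructor
        · exact fun hys => .inl ⟨(x, y), ⟨hy, hys⟩, rfl⟩
        · rintro (⟨⟨_, y'⟩, ⟨h1, h2⟩, rfl⟩ | h)
          · rwa [← hT hy, hT h1]
          · exact absurd ⟨_, hy, rfl⟩ h.2
      · rw [hT' h]
        constructor
        · refine fun hxs => .inr ⟨hxs, ?_⟩
          rintro ⟨⟨_, y⟩, hy, rfl⟩
          exact h ⟨y, hy⟩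
        · rintro (⟨⟨_, y⟩, ⟨hy, -⟩, rfl⟩ | hx)
          · exact absurd ⟨y, hy⟩ h
          · exact hx.1
    rw [this]
    exact ((hL.inter (measurable_snd hs)).image_of_measurable_injOn measurable_fst
      (hinj.mono inter_subset_left)).union
      (hs.diff (hL.image_of_measurable_injOn measurable_fst hinj))
  · by_cases h : ∃ y, (x, y) ∈ L
    · obtain ⟨y, hy⟩ := h
      refine .inr ?_
      rwa [Function.Involutive.coe_toPerm, hT hy]
    · exact .inl (hT' h)

open Set in
/-- **Feldman–Moore** modulo null sets: a countable Borel equivalence relation is generated, outside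
a null set, by countably many Borel involutions. -/
theorem exists_seq_involutions_generating {X : Type*} [MeasurableSpace X] [StandardBorelSpace X]
    (μ : Measure X) [IsFiniteMeasure μ] {R : X → X → Prop} (hR : Equivalence R)
    (hRmeas : MeasurableSet {p : X × X | R p.1 p.2}) (hcount : ∀ x, {y | R x y}.Countable) :
    ∃ γ : ℕ → X ≃ X, (∀ k, Measurable (γ k)) ∧ (∀ k, (γ k).symm = γ k) ∧
      (∀ k x, R x (γ k x)) ∧ ∀ᵐ x ∂μ, ∀ y, R x y → ∃ k, γ k x = y := by
  obtain ⟨𝒦, h𝒦, hK, hcover⟩ := exists_countable_partialInjection_cover μ hRmeas hcount fun y =>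
    (hcount y).mono fun x hx => hR.symm hx
  obtain ⟨C, hCm, hC⟩ := exists_seq_separating X (p := MeasurableSet) .univ univ
  let P (K : Set (X × X)) (n : ℕ) (i : Bool) : Set (X × X) :=
    K ∩ if i then C n ×ˢ (C n)ᶜ else (C n)ᶜ ×ˢ C n
  have hPdisj {K : Set (X × X)} {n : ℕ} {i : Bool} {x y z : X} (h : (x, y) ∈ P K n i)
      (h' : (z, x) ∈ P K n i) : False := by
    cases i <;> simp [P] at h h' <;> tauto
  have invol (K : Set (X × X)) (hK𝒦 : K ∈ 𝒦) (n : ℕ) (i : Bool) : ∃ T : X ≃ X, Measurable T ∧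
      T.symm = T ∧ (∀ x, R x (T x)) ∧ ∀ x y, (x, y) ∈ P K n i → T x = y := by
    obtain ⟨hKm, hKR, hKfst, hKsnd⟩ := hK K hK𝒦
    have hPm : MeasurableSet (P K n i) := by
      refine hKm.inter ?_
      split_ifs
      exacts [(hCm n).prod (hCm n).compl, (hCm n).compl.prod (hCm n)]
    have hPK : P K n i ⊆ K := inter_subset_left
    have hinj : InjOn Prod.fst (P K n i ∪ Prod.swap ⁻¹' P K n i) := by
      rintro ⟨x, y⟩ (h | h) ⟨_, y'⟩ (h' | h') rfl
      · exact hKfst (hPK h) (hPK h') rfl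
      · exact (hPdisj h h').elim
      · exact (hPdisj h' h).elim
      · exact congrArg Prod.swap (hKsnd (hPK h) (hPK h') rfl)
    obtain ⟨T, h1, h2, h3, h4⟩ := exists_measurable_involution
      (hPm.union (measurable_swap hPm)) hinj fun x y h => h.symm
    refine ⟨T, h1, h2, fun x => ?_, fun x y h => h4 x y (.inl h)⟩
    rcases h3 x with h | h | h
    · rw [h]
      exact hR.refl x
    · exact hKR (hPK h)
    · exact hR.symm (hKR (hPK h))
  choose! T hTm hTsymm hTR hTP using invol
  let Γ : Set (X ≃ X) := insert (Equiv.refl X) (⋃ K ∈ 𝒦, ⋃ n, ⋃ i, {T K n i})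
  have hΓ : Γ.Countable := (h𝒦.biUnion fun K _ => countable_iUnion fun n => countable_iUnion fun i =>
    countable_singleton _).insert _
  have hΓprop : ∀ g ∈ Γ, Measurable g ∧ g.symm = g ∧ ∀ x, R x (g x) := by
    rintro g (rfl | hg)
    · exact ⟨measurable_id, rfl, hR.refl⟩
    · simp only [mem_iUnion, mem_singleton_iff] at hg
      obtain ⟨K, hK', n, i, rfl⟩ := hg
      exact ⟨hTm K hK' n i, hTsymm K hK' n i, hTR K hK' n i⟩
  obtain ⟨γ, hγ⟩ := hΓ.exists_eq_range ⟨_, mem_insert _ _⟩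
  have hγΓ (k : ℕ) : γ k ∈ Γ := hγ ▸ mem_range_self k
  refine ⟨γ, fun k => (hΓprop _ (hγΓ k)).1, fun k => (hΓprop _ (hγΓ k)).2.1,
    fun k => (hΓprop _ (hγΓ k)).2.2, ?_⟩
  filter_upwards [hcover] with x hx y hxy
  suffices ∃ g ∈ Γ, g x = y by
    rw [hγ] at this
    simpa using this
  by_cases hne : x = y
  · exact ⟨_, mem_insert _ _, hne⟩
  obtain ⟨K, hK', hxK⟩ := hx y hxy
  obtain ⟨n, hn⟩ : ∃ n, ¬ (x ∈ C n ↔ y ∈ C n) := by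
    by_contra! h
    exact hne (hC x trivial y trivial h)
  have : ∃ i, (x, y) ∈ P K n i := by
    by_cases hxn : x ∈ C n
    · exact ⟨true, by simp [P]; tauto⟩
    · exact ⟨false, by simp [P]; tauto⟩
  obtain ⟨i, hi⟩ := this
  refine ⟨T K n i, .inr ?_, hTP K hK' n i x y hi⟩
  simp only [mem_iUnion, mem_singleton_iff]
  exact ⟨K, hK', n, i, rfl⟩

section FullGroup

open Set

variable {X : Type*} [MeasurableSpace X] {μ : Measure X} {R : X → X → Prop} {γ : ℕ → X ≃ X}

/-- Every null set is contained in an invariant Borel null set off which the sequence `γ` generates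
the equivalence relation. -/
theorem exists_invariant_null_superset (hR : Equivalence R) (hγ : ∀ k, MeasurePreserving (γ k) μ μ)
    (hgen : ∀ᵐ x ∂μ, ∀ y, R x y → ∃ k, γ k x = y) {s : Set X} (hs : μ s = 0) :
    ∃ N, s ⊆ N ∧ MeasurableSet N ∧ μ N = 0 ∧ (∀ x y, R x y → (x ∈ N ↔ y ∈ N)) ∧
      ∀ x ∉ N, ∀ y, R x y → ∃ k, γ k x = y := by
  let b : Set X := {x | ∀ y, R x y → ∃ k, γ k x = y}ᶜ
  let a : ℕ → Set X := fun n =>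
    Nat.rec (toMeasurable μ (s ∪ b)) (fun _ t => ⋃ k, γ k ⁻¹' t) n
  have ha0 : s ∪ b ⊆ a 0 := subset_toMeasurable _ _
  have ha (n : ℕ) : MeasurableSet (a n) ∧ μ (a n) = 0 := by
    induction n with
    | zero => exact ⟨measurableSet_toMeasurable _ _,
        (measure_toMeasurable _).trans (measure_union_null hs hgen)⟩
    | succ n ih => exact ⟨.iUnion fun k => (hγ k).measurable ih.1, measure_iUnion_null fun k =>
        ((hγ k).measure_preimage ih.1.nullMeasurableSet).trans ih.2⟩
  have hb {x : X} (hx : x ∉ ⋃ n, a n) (y : X) (hxy : R x y) : ∃ k, γ k x = y := by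
    by_contra h
    exact hx (mem_iUnion.2 ⟨0, ha0 (.inr fun h' => h (h' y hxy))⟩)
  have hinv (x y : X) (hxy : R x y) (hx : x ∈ ⋃ n, a n) : y ∈ ⋃ n, a n := by
    by_contra hy
    obtain ⟨k, rfl⟩ := hb hy x (hR.symm hxy)
    obtain ⟨n, hn⟩ := mem_iUnion.1 hx
    exact hy (mem_iUnion.2 ⟨n + 1, mem_iUnion.2 ⟨k, hn⟩⟩)
  exact ⟨⋃ n, a n, fun x hx => mem_iUnion.2 ⟨0, ha0 (.inl hx)⟩, .iUnion fun n => (ha n).1,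
    measure_iUnion_null fun n => (ha n).2, fun x y hxy => ⟨hinv x y hxy, hinv y x (hR.symm hxy)⟩,
    fun x hx => hb hx⟩

/-- The measure of the image of a set under an invertible measure preserving map. -/
theorem measure_image_equiv_of_measurePreserving {g : X ≃ X} (hg : MeasurePreserving g μ μ)
    (hg' : Measurable g.symm) (s : Set X) : μ (g '' s) = μ s := by
  let e : X ≃ᵐ X := ⟨g, hg.measurable, hg'⟩
  have he : MeasurePreserving e μ μ := hg
  rw [← he.measure_preimage_equiv (g '' s)]
  exact congrArg μ (g.preimage_image s)

/-- In an aperiodic pmp equivalence relation, almost no point of a Borel set `B` belongs to a class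
meeting `B` in a finite set. -/
theorem measure_setOf_finite_inter_class_eq_zero [MeasurableEq X] [IsFiniteMeasure μ]
    (hR : Equivalence R) (hγ : ∀ k, MeasurePreserving (γ k) μ μ)
    (hγ' : ∀ k, Measurable (γ k).symm) (hγR : ∀ k x, R x (γ k x))
    (hgen : ∀ᵐ x ∂μ, ∀ y, R x y → ∃ k, γ k x = y) (hinf : ∀ᵐ x ∂μ, {y | R x y}.Infinite)
    {B : Set X} (hB : MeasurableSet B) : μ {x ∈ B | ({y | R x y} ∩ B).Finite} = 0 := by
  obtain ⟨N, -, -, hN0, hNinv, hNgen⟩ :=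
    exists_invariant_null_superset hR hγ hgen (s := ∅) measure_empty
  let S : ℕ → Set X := fun n => {x | x ∈ B ∧ ∀ k, γ k x ∈ B → ∃ j < n, γ j x = γ k x}
  let C : ℕ → ℕ → Set X := fun n k => {x | x ∈ S n ∧ ∀ j < k, γ j x ≠ γ k x}
  have heq (j k : ℕ) : MeasurableSet {x | γ j x = γ k x} :=
    measurableSet_eq_fun (hγ j).measurable (hγ k).measurable
  have hS (n : ℕ) : MeasurableSet (S n) := by
    have : S n = B ∩ ⋂ k, ((γ k ⁻¹' B)ᶜ ∪ ⋃ j, ⋃ _ : j < n, {x | γ j x = γ k x}) := by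
      ext x
      simp [S, imp_iff_not_or]
    rw [this]
    exact hB.inter <| .iInter fun k => ((hγ k).measurable hB).compl.union <|
      .iUnion fun j => .iUnion fun _ => heq j k
  have hC (n k : ℕ) : MeasurableSet (C n k) := by
    have : C n k = S n ∩ ⋂ j, ⋂ _ : j < k, {x | γ j x = γ k x}ᶜ := by
      ext x
      simp [C]
    rw [this]
    exact (hS n).inter <| .iInter fun j => .iInter fun _ => (heq j k).compl
  have himage (n k : ℕ) : MeasurableSet (γ k '' C n k) := by
    rw [(γ k).image_eq_preimage_symm]
    exact hγ' k (hC n k)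
  have hmult (n : ℕ) : ∀ᵐ y ∂μ, ∑' k, (γ k '' C n k).indicator (1 : X → ENNReal) y ≤ n := by
    filter_upwards [measure_eq_zero_iff_ae_notMem.1 hN0] with y hy
    rw [ENNReal.tsum_eq_iSup_sum]
    refine iSup_le fun s => ?_
    classical
    have hsum : ∑ k ∈ s, (γ k '' C n k).indicator (1 : X → ENNReal) y =
        (s.filter fun k => y ∈ γ k '' C n k).card := by
      simp only [Set.indicator_apply, Pi.one_apply, Finset.sum_boole]
    rw [hsum]
    norm_cast
    set s' := s.filter fun k => y ∈ γ k '' C n k with hs'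
    have hmem (k : ℕ) (hk : k ∈ s') : (γ k).symm y ∈ C n k := by
      obtain ⟨x, hx, rfl⟩ := (Finset.mem_filter.1 hk).2
      simpa using hx
    have hrel (k : ℕ) : R ((γ k).symm y) y := by
      simpa using hγR k ((γ k).symm y)
    obtain hempty | ⟨k₀, hk₀⟩ := s'.eq_empty_or_nonempty
    · simp [hempty]
    have hx₀ : (γ k₀).symm y ∉ N := fun h => hy ((hNinv _ _ (hrel k₀)).1 h)
    calc s'.card ≤ ((Finset.range n).image fun j => γ j ((γ k₀).symm y)).card := by
          refine Finset.card_le_card_of_injOn (fun k => (γ k).symm y) (fun k hk => ?_) ?_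
          · obtain ⟨i, hi⟩ := hNgen _ hx₀ _ (hR.trans (hrel k₀) (hR.symm (hrel k)))
            obtain ⟨j, hj, hji⟩ := (hmem k₀ hk₀).1.2 i (hi ▸ (hmem k hk).1.1)
            exact Finset.mem_coe.2 (Finset.mem_image.2 ⟨j, Finset.mem_range.2 hj, hji.trans hi⟩)
          · intro k hk l hl hkl
            have hkl : (γ k).symm y = (γ l).symm y := hkl
            have hy1 : γ k ((γ k).symm y) = y := (γ k).apply_symm_apply y
            have hy2 : γ l ((γ k).symm y) = y := by rw [hkl, (γ l).apply_symm_apply y]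
            rcases lt_trichotomy k l with h | h | h
            · exact absurd (by rw [← hkl, hy1, hy2]) ((hmem l hl).2 k h)
            · exact h
            · exact absurd (by rw [hy1, hy2]) ((hmem k hk).2 l h)
      _ ≤ n := Finset.card_image_le.trans (Finset.card_range n).le
  have hsum (n : ℕ) : ∑' k, μ (C n k) ≠ ⊤ := by
    have : ∑' k, μ (C n k) ≤ n * μ univ :=
      calc ∑' k, μ (C n k)
          = ∑' k, ∫⁻ y, (γ k '' C n k).indicator 1 y ∂μ := by
            refine tsum_congr fun k => ?_
            rw [lintegral_indicator_one (himage n k),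
              measure_image_equiv_of_measurePreserving (hγ k) (hγ' k)]
        _ = ∫⁻ y, ∑' k, (γ k '' C n k).indicator 1 y ∂μ :=
            (lintegral_tsum fun k => (measurable_one.indicator (himage n k)).aemeasurable).symm
        _ ≤ ∫⁻ _, n ∂μ := lintegral_mono_ae (hmult n)
        _ = n * μ univ := lintegral_const _
    exact ne_top_of_le_ne_top (ENNReal.mul_ne_top (ENNReal.natCast_ne_top n) (measure_ne_top _ _)) this
  rw [measure_eq_zero_iff_ae_notMem]
  filter_upwards [ae_all_iff.2 fun n => ae_finite_setOfPred_mem (hsum n), hgen, hinf] with x hfin hx hxinf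
  rintro ⟨hxB, hxfin⟩
  have : ∃ n, x ∈ S n := by
    have hsub : ∀ z ∈ {z | (∃ k, γ k x = z) ∧ z ∈ B}, ∃ k, γ k x = z := fun z hz => hz.1
    choose! i hi using hsub
    have hfin' : {z | (∃ k, γ k x = z) ∧ z ∈ B}.Finite := hxfin.subset <| by
      rintro _ ⟨⟨k, rfl⟩, hz⟩
      exact ⟨hγR k x, hz⟩
    obtain ⟨n, hn⟩ := (hfin'.image i).bddAbove
    refine ⟨n + 1, hxB, fun k hk => ⟨i (γ k x), ?_, hi _ ⟨⟨k, rfl⟩, hk⟩⟩⟩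
    exact Nat.lt_succ_of_le (hn (mem_image_of_mem i ⟨⟨k, rfl⟩, hk⟩))
  obtain ⟨n, hn⟩ := this
  refine hxinf (((hfin n).image fun k => γ k x).subset fun y hy => ?_)
  classical
  have hex := hx y hy
  refine ⟨Nat.find hex, ⟨hn, fun j hj h => ?_⟩, Nat.find_spec hex⟩
  exact Nat.find_min hex hj (h.trans (Nat.find_spec hex))

/-- A greedy matching along the maps `γ k`, subject to the constraint that `x` is not matched with an
element of `F x`. -/
theorem exists_greedy_matching (hγ : ∀ k, Measurable (γ k)) (hγ' : ∀ k, Measurable (γ k).symm)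
    {F : X → Set X} (hF : MeasurableSet {p : X × X | p.2 ∈ F p.1}) :
    ∃ D : ℕ → Set X, (∀ k, MeasurableSet (D k)) ∧ Pairwise (Function.onFun Disjoint D) ∧
      Pairwise (Function.onFun Disjoint fun k => γ k '' D k) ∧ (∀ k, ∀ x ∈ D k, γ k x ∉ F x) ∧
      ∀ k x, x ∉ ⋃ j, D j → γ k x ∉ ⋃ j, γ j '' D j → γ k x ∈ F x := by
  let next (k : ℕ) (p : Set X × Set X) : Set X := {x | x ∉ p.1 ∧ γ k x ∉ p.2 ∧ γ k x ∉ F x}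
  let st : ℕ → Set X × Set X := fun k => Nat.rec (∅, ∅)
    (fun k p => (p.1 ∪ next k p, p.2 ∪ γ k '' next k p)) k
  let D : ℕ → Set X := fun k => next k (st k)
  have hst1 (k : ℕ) : (st k).1 = ⋃ j, ⋃ _ : j < k, D j := by
    induction k with
    | zero => simp [st]
    | succ k ih =>
      rw [biUnion_lt_succ, ← ih]
  have hst2 (k : ℕ) : (st k).2 = ⋃ j, ⋃ _ : j < k, γ j '' D j := by
    induction k with
    | zero => simp [st]
    | succ k ih =>
      rw [biUnion_lt_succ, ← ih]
  have himage (k : ℕ) {s : Set X} (hs : MeasurableSet s) : MeasurableSet (γ k '' s) := by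
    rw [(γ k).image_eq_preimage_symm]
    exact hγ' k hs
  have hnext (k : ℕ) (p : Set X × Set X) (h1 : MeasurableSet p.1) (h2 : MeasurableSet p.2) :
      MeasurableSet (next k p) :=
    h1.compl.inter <| (hγ k h2).compl.inter (measurable_id.prodMk (hγ k) hF).compl
  have hstm (k : ℕ) : MeasurableSet (st k).1 ∧ MeasurableSet (st k).2 := by
    induction k with
    | zero => exact ⟨.empty, .empty⟩
    | succ k ih => exact ⟨ih.1.union (hnext k _ ih.1 ih.2), ih.2.union (himage k (hnext k _ ih.1 ih.2))⟩
  refine ⟨D, fun k => hnext k _ (hstm k).1 (hstm k).2, ?_, ?_, fun k x hx => hx.2.2, ?_⟩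
  · refine (pairwise_disjoint_on D).2 fun j k hjk => Set.disjoint_left.2 fun x hxj hxk => ?_
    refine hxk.1 ?_
    rw [hst1]
    exact mem_iUnion₂.2 ⟨j, hjk, hxj⟩
  · refine (pairwise_disjoint_on _).2 fun j k hjk => Set.disjoint_left.2 fun y hyj hyk => ?_
    obtain ⟨x, hx, rfl⟩ := hyk
    refine hx.2.1 ?_
    rw [hst2]
    exact mem_iUnion₂.2 ⟨j, hjk, hyj⟩
  · intro k x hx hy
    by_contra hF'
    refine hx (mem_iUnion.2 ⟨k, ⟨fun h => hx ?_, fun h => hy ?_, hF'⟩⟩)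
    · rw [hst1] at h
      exact iUnion₂_subset_iUnion _ _ h
    · rw [hst2] at h
      exact iUnion₂_subset_iUnion _ _ h

/-- A countable matching of conull sets along the maps `γ k` can be changed on an invariant null set
to a measurable bijection. -/
theorem exists_measurable_equiv_of_matching [StandardBorelSpace X] (hR : Equivalence R)
    (hγ : ∀ k, Measurable (γ k)) (hγR : ∀ k x, R x (γ k x)) {D : ℕ → Set X}
    (hD : ∀ k, MeasurableSet (D k)) (hdisj : Pairwise (Function.onFun Disjoint D))
    (hdisj' : Pairwise (Function.onFun Disjoint fun k => γ k '' D k)) {N : Set X}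
    (hN : MeasurableSet N) (hNinv : ∀ x y, R x y → (x ∈ N ↔ y ∈ N)) (hND : Nᶜ ⊆ ⋃ k, D k)
    (hND' : Nᶜ ⊆ ⋃ k, γ k '' D k) :
    ∃ T : X ≃ X, Measurable T ∧ Measurable T.symm ∧ (∀ x, R x (T x)) ∧
      ∀ x ∉ N, ∃ k, x ∈ D k ∧ T x = γ k x := by
  classical
  choose! i hi using fun x (hx : x ∈ Nᶜ) => mem_iUnion.1 (hND hx)
  let T : X → X := fun x => if x ∈ N then x else γ (i x) x
  have hTN {x : X} (hx : x ∈ N) : T x = x := if_pos hx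
  have hT {x : X} {k : ℕ} (hx : x ∉ N) (hk : x ∈ D k) : T x = γ k x := by
    rw [← hdisj.eq (not_disjoint_iff.2 ⟨x, hi x hx, hk⟩)]
    exact if_neg hx
  have hTR (x : X) : R x (T x) := by
    by_cases hx : x ∈ N
    · rw [hTN hx]
      exact hR.refl x
    · rw [hT hx (hi x hx)]
      exact hγR _ x
  have hTmem (x : X) : T x ∈ N ↔ x ∈ N := (hNinv _ _ (hTR x)).symm
  have hinj : Function.Injective T := fun x y hxy => by
    by_cases hx : x ∈ N
    · have hy : y ∈ N := by rwa [← hTmem, ← hxy, hTmem]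
      rwa [hTN hx, hTN hy] at hxy
    · have hy : y ∉ N := by rwa [← hTmem, ← hxy, hTmem]
      rw [hT hx (hi x hx), hT hy (hi y hy)] at hxy
      have : i x = i y := hdisj'.eq (not_disjoint_iff.2
        ⟨γ (i x) x, mem_image_of_mem _ (hi x hx), hxy ▸ mem_image_of_mem _ (hi y hy)⟩)
      rw [this] at hxy
      exact (γ _).injective hxy
  have hsurj : Function.Surjective T := fun y => by
    by_cases hy : y ∈ N
    · exact ⟨y, hTN hy⟩
    · obtain ⟨k, x, hx, rfl⟩ := mem_iUnion.1 (hND' hy)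
      exact ⟨x, hT (fun h => hy ((hNinv _ _ (hγR k x)).1 h)) hx⟩
  have hmeas : Measurable T := fun s hs => by
    have : T ⁻¹' s = (N ∩ s) ∪ ⋃ k, (Nᶜ ∩ D k ∩ γ k ⁻¹' s) := by
      ext x
      by_cases hx : x ∈ N
      · simp [hx, hTN hx]
      · simp only [mem_preimage, mem_union, mem_inter_iff, hx, false_and, false_or, mem_iUnion,
          mem_compl_iff, not_false_eq_true, true_and]
        constructor
        · exact fun h => ⟨i x, hi x hx, by rwa [← hT hx (hi x hx)]⟩
        · rintro ⟨k, hk, h⟩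
          rwa [hT hx hk]
    rw [this]
    exact (hN.inter hs).union (.iUnion fun k => (hN.compl.inter (hD k)).inter (hγ k hs))
  let e : X ≃ X := Equiv.ofBijective T ⟨hinj, hsurj⟩
  refine ⟨e, hmeas, fun s hs => ?_, hTR, fun x hx => ⟨i x, hi x hx, hT hx (hi x hx)⟩⟩
  rw [← e.image_eq_preimage_symm]
  exact hs.image_of_measurable_injOn hmeas hinj.injOn

end FullGroup

/-- Let `R` be an ergodic countable pmp equivalence relation on a standard
probability space `(X, μ)` with almost every class infinite, and let
`F : X → {finite subsets of X}` be a Borel assignment with `F x ⊆ [x]_R` for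
a.e. `x`. Then for every `ε > 0` there is an element `T` of the full group
`[R]` with `μ {x : T x ∈ F x} < ε`. -/
theorem exists_fullGroup_avoiding_finite_sets
    (X : Type) [MeasurableSpace X] [StandardBorelSpace X]
    (μ : Measure X) [IsProbabilityMeasure μ]
    (R : X → X → Prop) (hR : Equivalence R)
    (hRmeas : MeasurableSet {p : X × X | R p.1 p.2})
    (hcount : ∀ x : X, {y | R x y}.Countable)
    (hpmp : ∀ T : X ≃ X, Measurable T → Measurable T.symm →
      (∀ᵐ x ∂μ, R x (T x)) → MeasurePreserving T μ μ)
    (herg : ∀ s : Set X, MeasurableSet s →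
      (∀ x y : X, R x y → (x ∈ s ↔ y ∈ s)) → μ s = 0 ∨ μ s = 1)
    (hinf : ∀ᵐ x ∂μ, {y | R x y}.Infinite)
    (F : X → Set X) (hFfin : ∀ x, (F x).Finite)
    (hFmeas : MeasurableSet {p : X × X | p.2 ∈ F p.1})
    (hFsub : ∀ᵐ x ∂μ, F x ⊆ {y | R x y})
    (ε : ℝ) (hε : 0 < ε) :
    ∃ T : X ≃ X, Measurable T ∧ Measurable T.symm ∧
      MeasurePreserving T μ μ ∧ (∀ᵐ x ∂μ, R x (T x)) ∧
      μ {x | T x ∈ F x} < ENNReal.ofReal ε := by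
  obtain ⟨γ, hγ, hγsymm, hγR, hgen⟩ := exists_seq_involutions_generating μ hR hRmeas hcount
  have hγ' (k : ℕ) : Measurable (γ k).symm := by
    rw [hγsymm]
    exact hγ k
  have hγμ (k : ℕ) : MeasurePreserving (γ k) μ μ := hpmp _ (hγ k) (hγ' k) (ae_of_all _ (hγR k))
  obtain ⟨D, hD, hdisj, hdisj', hDF, hmax⟩ := exists_greedy_matching hγ hγ' hFmeas
  set A : Set X := (⋃ k, D k)ᶜ with hA
  set B : Set X := (⋃ k, γ k '' D k)ᶜ with hB
  have himage (k : ℕ) : MeasurableSet (γ k '' D k) := by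
    rw [(γ k).image_eq_preimage_symm]
    exact hγ' k (hD k)
  have hBm : MeasurableSet B := (MeasurableSet.iUnion himage).compl
  have hAB : μ A = μ B := by
    rw [prob_compl_eq_one_sub (.iUnion hD), prob_compl_eq_one_sub (.iUnion himage),
      measure_iUnion hdisj hD, measure_iUnion hdisj' himage]
    simp_rw [measure_image_equiv_of_measurePreserving (hγμ _) (hγ' _)]
  have hB0 : μ B = 0 := by
    obtain ⟨N, -, hNm, hN0, hNinv, hNgen⟩ :=
      exists_invariant_null_superset hR hγμ hgen (s := ∅) measure_empty
    let S : Set X := (⋃ k, γ k ⁻¹' B) \ N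
    have hSm : MeasurableSet S := (MeasurableSet.iUnion fun k => hγ k hBm).diff hNm
    have hSB {x y : X} (hx : x ∉ N) (hxy : R x y) (hy : y ∈ B) : x ∈ S := by
      obtain ⟨k, rfl⟩ := hNgen x hx y hxy
      exact ⟨Set.mem_iUnion.2 ⟨k, hy⟩, hx⟩
    have hSinv {x y : X} (hxy : R x y) (hx : x ∈ S) : y ∈ S := by
      obtain ⟨k, hk⟩ := Set.mem_iUnion.1 hx.1
      exact hSB (mt (hNinv x y hxy).2 hx.2) (hR.trans (hR.symm hxy) (hγR k x)) hk
    rcases herg S hSm fun x y hxy => ⟨hSinv hxy, hSinv (hR.symm hxy)⟩ with h0 | h1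
    · refine measure_mono_null (fun x hx => ?_) (measure_union_null h0 hN0)
      by_cases hxN : x ∈ N
      exacts [.inr hxN, .inl (hSB hxN (hR.refl x) hx)]
    · rw [← hAB, measure_eq_zero_iff_ae_notMem]
      let P : Set X := {x ∈ B | ({y | R x y} ∩ B).Finite}
      have hP : ∀ᵐ x ∂μ, ∀ k, γ k x ∉ P := ae_all_iff.2 fun k =>
        (hγμ k).quasiMeasurePreserving.ae (measure_eq_zero_iff_ae_notMem.1
          (measure_setOf_finite_inter_class_eq_zero hR hγμ hγ' hγR hgen hinf hBm))
      filter_upwards [hP, (mem_ae_iff_prob_eq_one hSm).2 h1] with x hxP hxS hxA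
      obtain ⟨k, hk⟩ := Set.mem_iUnion.1 hxS.1
      refine hxP k ⟨hk, (hFfin x).subset ?_⟩
      rintro y ⟨hxy, hyB⟩
      obtain ⟨j, rfl⟩ := hNgen x hxS.2 y (hR.trans (hγR k x) hxy)
      exact hmax j x hxA hyB
  obtain ⟨N, hABN, hNm, hN0, hNinv, -⟩ := exists_invariant_null_superset hR hγμ hgen
    (measure_union_null (hAB.trans hB0) hB0)
  obtain ⟨T, hT, hT', hTR, hTD⟩ := exists_measurable_equiv_of_matching hR hγ hγR hD hdisj hdisj' hNm
    hNinv (Set.compl_subset_comm.1 (Set.subset_union_left.trans hABN))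
    (Set.compl_subset_comm.1 (Set.subset_union_right.trans hABN))
  refine ⟨T, hT, hT', hpmp T hT hT' (ae_of_all _ hTR), ae_of_all _ hTR, ?_⟩
  have hTF : μ {x | T x ∈ F x} = 0 := by
    refine measure_mono_null (fun x hx => ?_) hN0
    by_contra hxN
    obtain ⟨k, hk, hTk⟩ := hTD x hxN
    exact hDF k x hk (hTk ▸ hx)
  rw [hTF]
  exact ENNReal.ofReal_pos.2 hε
end
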